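/- arXiv:1005.0478 — 2 statements merged into one kernel-verified Lean document; each statement's English description precedes it below -/
import Mathlib

section
/- Let Q : ℝ^{2q+2} × ℝ^{2q+2} → ℝ be a nondegenerate alternating bilinear form, extended ℂ-bilinearly to ℂ^{2q+2}, and set H(v,w) := i·Q(v, conj(w)). Let W ⊆ ℂ^{2q+2} be a complex subspace with dim_ℂ W = q+1, with Q(w,w') = 0 for all w, w' ∈ W, and with H(v,v) > 0 for all nonzero v ∈ W. Let W_1 ⊆ W be a one-dimensional subspace and let W_1^⊥ := {w ∈ W : H(u,w) = 0 for all u ∈ W_1} be its H-orthogonal complement in W. Then ℂ^{2q+2} = W_1 ⊕ conj(W_1^⊥) ⊕ W_1^⊥ ⊕ conj(W_1), these four subspaces are pairwise H-orthogonal, H is positive definite on W_1 and on W_1^⊥, and H is negative definite on conj(W_1^⊥) and on conj(W_1). -/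
namespace RealAlternatingForm

variable {n : ℕ}

theorem eq_re_add_im (v : Fin n → ℂ) :
    v = (fun i => ((v i).re : ℂ)) + Complex.I • (fun i => ((v i).im : ℂ)) := by
  ext i
  simp [mul_comm Complex.I, Complex.re_add_im]

theorem star_eq_re_sub_im (v : Fin n → ℂ) :
    star v = (fun i => ((v i).re : ℂ)) - Complex.I • (fun i => ((v i).im : ℂ)) := by
  ext i
  apply Complex.ext <;> simp

/-- The complexification of a real bilinear form commutes with conjugation. -/
theorem apply_star_star {QR : LinearMap.BilinForm ℝ (Fin n → ℝ)}
    {Q : LinearMap.BilinForm ℂ (Fin n → ℂ)}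
    (hext : ∀ v w : Fin n → ℝ,
      Q (fun i => (v i : ℂ)) (fun i => (w i : ℂ)) = (QR v w : ℂ))
    (v w : Fin n → ℂ) : Q (star v) (star w) = star (Q v w) := by
  conv_rhs => rw [eq_re_add_im v, eq_re_add_im w]
  rw [star_eq_re_sub_im v, star_eq_re_sub_im w]
  simp only [map_add, map_sub, map_smul, LinearMap.add_apply, LinearMap.sub_apply,
    LinearMap.smul_apply, hext, smul_eq_mul, star_add, star_mul', Complex.star_def,
    Complex.conj_ofReal, Complex.conj_I]
  ring

/-- The complexification of a real alternating form is skew-symmetric. -/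
theorem apply_eq_neg_swap {QR : LinearMap.BilinForm ℝ (Fin n → ℝ)}
    (haltR : ∀ v, QR v v = 0)
    {Q : LinearMap.BilinForm ℂ (Fin n → ℂ)}
    (hext : ∀ v w : Fin n → ℝ,
      Q (fun i => (v i : ℂ)) (fun i => (w i : ℂ)) = (QR v w : ℂ))
    (v w : Fin n → ℂ) : Q v w = -Q w v := by
  have hskew (x y : Fin n → ℝ) : (QR x y : ℂ) = -QR y x := by
    rw [← Complex.ofReal_neg, LinearMap.IsAlt.neg (B := QR) haltR]
  rw [eq_re_add_im v, eq_re_add_im w]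
  simp only [map_add, map_smul, LinearMap.add_apply, LinearMap.smul_apply, hext, smul_eq_mul]
  rw [hskew (fun i => (v i).re) (fun i => (w i).re), hskew (fun i => (v i).re) (fun i => (w i).im),
    hskew (fun i => (v i).im) (fun i => (w i).re), hskew (fun i => (v i).im) (fun i => (w i).im)]
  ring

/-- A half-dimensional subspace meeting its conjugate trivially spans, together with its
conjugate, the whole space. -/
theorem exists_add_star_eq {W : Submodule ℂ (Fin n → ℂ)}
    (hdim : 2 * Module.finrank ℂ W = n) (hW : ∀ v ∈ W, star v ∈ W → v = 0)
    (v : Fin n → ℂ) : ∃ a ∈ W, ∃ b ∈ W, v = a + star b := by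
  let T : (W × W) →ₗ[ℝ] (Fin n → ℂ) :=
    { toFun := fun x => (x.1 : Fin n → ℂ) + star (x.2 : Fin n → ℂ)
      map_add' := fun x y => by
        simp only [Prod.fst_add, Prod.snd_add, Submodule.coe_add, star_add]
        abel
      map_smul' := fun r x => by
        ext i
        simp }
  have hinj : Function.Injective T := by
    rw [← LinearMap.ker_eq_bot, LinearMap.ker_eq_bot']
    rintro ⟨a, b⟩ h
    have hab : (a : Fin n → ℂ) + star (b : Fin n → ℂ) = 0 := h
    have hb : (b : Fin n → ℂ) = 0 := by
      refine hW _ b.2 ?_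
      rw [← neg_eq_of_add_eq_zero_right hab]
      exact W.neg_mem a.2
    have ha : (a : Fin n → ℂ) = 0 := by simpa [hb] using hab
    exact Prod.ext (Subtype.ext ha) (Subtype.ext hb)
  have hfin : Module.finrank ℝ (W × W) = Module.finrank ℝ (Fin n → ℂ) := by
    rw [Module.finrank_prod, finrank_real_of_complex W, finrank_real_of_complex (Fin n → ℂ),
      Module.finrank_fin_fun]
    lia
  obtain ⟨x, hx⟩ := (LinearMap.injective_iff_surjective_of_finrank_eq_finrank hfin).1 hinj v
  exact ⟨x.1, x.1.2, x.2, x.2.2, hx.symm⟩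

end RealAlternatingForm

open RealAlternatingForm in

/-- **Construction of a polarised weight three Hodge structure of CY type.**
Let `QR` be a nondegenerate alternating bilinear form on `ℝ^{2q+2}`, `Q` its
`ℂ`-bilinear extension to `ℂ^{2q+2}`, and `H(v,w) := i·Q(v, conj w)`.
Let `W` be a `(q+1)`-dimensional complex subspace on which `Q` vanishes identically
and `H` is positive definite, let `W₁ ⊆ W` be a line, and let
`P = W₁^⊥ = {w ∈ W : H(u,w) = 0 for all u ∈ W₁}` be its `H`-orthogonal complement
in `W`.  Then `ℂ^{2q+2} = W₁ ⊕ conj(P) ⊕ P ⊕ conj(W₁)` (every vector is uniquely a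
sum of elements of the four pieces), the four subspaces are pairwise `H`-orthogonal,
`H` is positive definite on `W₁` and on `P`, and negative definite on `conj(P)` and
on `conj(W₁)`. -/
theorem hodge_structure_decomposition (q : ℕ)
    (QR : LinearMap.BilinForm ℝ (Fin (2 * q + 2) → ℝ))
    (haltR : ∀ v, QR v v = 0)
    (hndR : ∀ v, (∀ w, QR v w = 0) → v = 0)
    (Q : LinearMap.BilinForm ℂ (Fin (2 * q + 2) → ℂ))
    (hext : ∀ v w : Fin (2 * q + 2) → ℝ,
      Q (fun i => (v i : ℂ)) (fun i => (w i : ℂ)) = (QR v w : ℂ))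
    (c : (Fin (2 * q + 2) → ℂ) → (Fin (2 * q + 2) → ℂ))
    (hc : c = fun v i => starRingEnd ℂ (v i))
    (H : (Fin (2 * q + 2) → ℂ) → (Fin (2 * q + 2) → ℂ) → ℂ)
    (hH : H = fun v w => Complex.I * Q v (c w))
    (W W₁ : Submodule ℂ (Fin (2 * q + 2) → ℂ))
    (hWdim : Module.finrank ℂ W = q + 1)
    (hLag : ∀ v ∈ W, ∀ w ∈ W, Q v w = 0)
    (hWpos : ∀ v ∈ W, v ≠ 0 → 0 < (H v v).re)
    (hW₁le : W₁ ≤ W) (hW₁dim : Module.finrank ℂ W₁ = 1)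
    (P : Set (Fin (2 * q + 2) → ℂ))
    (hP : P = {w | w ∈ W ∧ ∀ u ∈ W₁, H u w = 0}) :
    -- direct sum decomposition ℂ^{2q+2} = W₁ ⊕ conj(P) ⊕ P ⊕ conj(W₁)
    (∀ v : Fin (2 * q + 2) → ℂ,
      ∃! x : (Fin (2 * q + 2) → ℂ) × (Fin (2 * q + 2) → ℂ) ×
             (Fin (2 * q + 2) → ℂ) × (Fin (2 * q + 2) → ℂ),
        x.1 ∈ W₁ ∧ x.2.1 ∈ P ∧ x.2.2.1 ∈ P ∧ x.2.2.2 ∈ W₁ ∧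
        v = x.1 + c x.2.1 + x.2.2.1 + c x.2.2.2) ∧
    -- pairwise H-orthogonality of the four pieces
    (∀ a ∈ W₁, ∀ b ∈ P, H a (c b) = 0) ∧
    (∀ a ∈ W₁, ∀ b ∈ P, H a b = 0) ∧
    (∀ a ∈ W₁, ∀ d ∈ W₁, H a (c d) = 0) ∧
    (∀ b ∈ P, ∀ b' ∈ P, H (c b) b' = 0) ∧
    (∀ b ∈ P, ∀ d ∈ W₁, H (c b) (c d) = 0) ∧
    (∀ b ∈ P, ∀ d ∈ W₁, H b (c d) = 0) ∧
    -- positive definiteness on W₁ and on P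
    (∀ v ∈ W₁, v ≠ 0 → 0 < (H v v).re) ∧
    (∀ v ∈ P, v ≠ 0 → 0 < (H v v).re) ∧
    -- negative definiteness on conj(P) and conj(W₁)
    (∀ v ∈ P, v ≠ 0 → (H (c v) (c v)).re < 0) ∧
    (∀ v ∈ W₁, v ≠ 0 → (H (c v) (c v)).re < 0) := by
  obtain rfl : c = star := hc
  have hHa (v w) : H v w = Complex.I * Q v (star w) := by rw [hH]
  have hPm (w) : w ∈ P ↔ w ∈ W ∧ ∀ u ∈ W₁, H u w = 0 := by rw [hP]; rfl
  have hsymm (v w) : H w v = star (H v w) := by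
    rw [hHa, hHa, apply_eq_neg_swap haltR hext, star_mul', ← apply_star_star hext, star_star]
    simp
  have hstar (v w) : H (star v) (star w) = -H w v := by
    rw [hHa, hHa, star_star, apply_eq_neg_swap haltR hext, mul_neg]
  have hWstar (v) (hv : v ∈ W) (w) (hw : w ∈ W) : H v (star w) = 0 := by
    rw [hHa, star_star, hLag v hv w hw, mul_zero]
  have hsub (u v w) : H u (v - w) = H u v - H u w := by
    simp only [hHa, star_sub, map_sub, mul_sub]
  have hW0 (v) (hv : v ∈ W) (h : H v v = 0) : v = 0 := by
    by_contra hne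
    simpa [h] using hWpos v hv hne
  have hdisj (v) (hv : v ∈ W) (hv' : star v ∈ W) : v = 0 :=
    hW0 v hv (by simpa using hWstar v hv _ hv')
  have hneg (v) (hv : v ∈ W) (hne : v ≠ 0) : (H (star v) (star v)).re < 0 := by
    rw [hstar, Complex.neg_re]
    exact neg_neg_of_pos (hWpos v hv hne)
  have hPW (w) (hw : w ∈ P) : w ∈ W := ((hPm w).1 hw).1
  have hPsub (v) (hv : v ∈ P) (w) (hw : w ∈ P) : v - w ∈ P := by
    rw [hPm] at *
    refine ⟨W.sub_mem hv.1 hw.1, fun u hu => ?_⟩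
    rw [hsub, hv.2 u hu, hw.2 u hu, sub_zero]
  have hsplit (w) (hw : w ∈ W) : ∃ a ∈ W₁, ∃ b ∈ P, w = a + b := by
    obtain ⟨u, hu0, hu⟩ := finrank_eq_one_iff'.1 hW₁dim
    have huu : H u u ≠ 0 := fun h => hu0 (Subtype.ext (hW0 u (hW₁le u.2) h))
    refine ⟨star (H u w / H u u) • (u : Fin (2 * q + 2) → ℂ), W₁.smul_mem _ u.2,
      w - star (H u w / H u u) • (u : Fin (2 * q + 2) → ℂ), ?_, by abel⟩
    rw [hPm]
    refine ⟨W.sub_mem hw (W.smul_mem _ (hW₁le u.2)), fun x hx => ?_⟩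
    obtain ⟨r, hr⟩ := hu ⟨x, hx⟩
    obtain rfl : r • (u : Fin (2 * q + 2) → ℂ) = x := congrArg Subtype.val hr
    have hl (y) : H (r • (u : Fin (2 * q + 2) → ℂ)) y = r * H u y := by
      simp only [hHa, map_smul, LinearMap.smul_apply, smul_eq_mul]
      ring
    have hs (s : ℂ) : H u (star s • (u : Fin (2 * q + 2) → ℂ)) = s * H u u := by
      simp only [hHa, star_smul, star_star, map_smul, smul_eq_mul]
      ring
    rw [hl, hsub, hs, div_mul_cancel₀ _ huu, sub_self, mul_zero]
  have hsplit_unique (a) (ha : a ∈ W₁) (a') (ha' : a' ∈ W₁) (b) (hb : b ∈ P) (b') (hb' : b' ∈ P)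
      (h : a + b = a' + b') : a = a' ∧ b = b' := by
    have heq : a - a' = b' - b := by
      rw [sub_eq_sub_iff_add_eq_add, h, add_comm a' b']
    have h0 : a - a' = 0 := by
      refine hW0 _ (hW₁le (W₁.sub_mem ha ha')) ?_
      nth_rw 2 [heq]
      exact ((hPm _).1 (hPsub _ hb' _ hb)).2 _ (W₁.sub_mem ha ha')
    exact ⟨sub_eq_zero.1 h0, (sub_eq_zero.1 (heq ▸ h0)).symm⟩
  refine ⟨fun v => ?_, fun a ha b hb => hWstar a (hW₁le ha) b (hPW b hb),
    fun a ha b hb => ((hPm b).1 hb).2 a ha,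
    fun a ha d hd => hWstar a (hW₁le ha) d (hW₁le hd), fun b hb b' hb' => ?_,
    fun b hb d hd => ?_, fun b hb d hd => hWstar b (hPW b hb) d (hW₁le hd),
    fun v hv => hWpos v (hW₁le hv), fun v hv => hWpos v (hPW v hv),
    fun v hv => hneg v (hPW v hv), fun v hv => hneg v (hW₁le hv)⟩
  · obtain ⟨w, hw, w', hw', rfl⟩ := exists_add_star_eq (by lia) hdisj v
    obtain ⟨a, ha, b, hb, rfl⟩ := hsplit w hw
    obtain ⟨a', ha', b', hb', rfl⟩ := hsplit w' hw'
    refine ⟨(a, b', b, a'), ⟨ha, hb', hb, ha', ?_⟩, ?_⟩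
    · simp only [star_add]
      abel
    · rintro ⟨x, y, z, t⟩ ⟨hx, hy, hz, ht, h⟩
      dsimp only at hx hy hz ht h
      have heq : star ((a' + b') - (t + y)) = (x + z) - (a + b) := by
        rw [star_sub, star_add t y, sub_eq_sub_iff_add_eq_add, add_comm (star _), h]
        abel
      have h0 : (a' + b') - (t + y) = 0 := by
        refine hdisj _ (W.sub_mem hw' (W.add_mem (hW₁le ht) (hPW y hy))) ?_
        rw [heq]
        exact W.sub_mem (W.add_mem (hW₁le hx) (hPW z hz)) hw
      rw [h0, star_zero] at heq
      obtain ⟨rfl, rfl⟩ := hsplit_unique a' ha' t ht b' hb' y hy (sub_eq_zero.1 h0)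
      obtain ⟨rfl, rfl⟩ := hsplit_unique x hx a ha z hz b hb (sub_eq_zero.1 heq.symm)
      rfl
  · rw [← star_star b', hstar, hsymm, hWstar b (hPW b hb) b' (hPW b' hb')]
    simp
  · rw [hstar, ((hPm b).1 hb).2 d hd, neg_zero]
end

section
/- Let ξ ∈ ℂ be a primitive cube root of unity and let a ∈ ℂ. For all v, x, y ∈ ℂ with v^3 = a and y^2 = x^3 + 1, the following hold: (i) the pair (X, Y) := (v^2·x, v^3·y) satisfies Y^2 = X^3 + a^2; (ii) replacing (v, x, y) by (ξv, ξx, y) produces the same pair (X, Y), i.e. ((ξv)^2·(ξx), (ξv)^3·y) = (v^2·x, v^3·y); and (iii) if v ≠ 0, v' ≠ 0, v'^3 = a, y'^2 = x'^3 + 1 and (v'^2·x', v'^3·y') = (v^2·x, v^3·y), then there exists k ∈ {0, 1, 2} with v' = ξ^k·v, x' = ξ^k·x and y' = y. -/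
/-- **The birational isomorphism `(C_f × E)/(β_f × α_E) → S_f`.**
Let `ξ` be a primitive cube root of unity and `a ∈ ℂ`.  For `v, x, y ∈ ℂ` with
`v³ = a` and `y² = x³ + 1`:
(i) the pair `(X, Y) = (v²x, v³y)` satisfies `Y² = X³ + a²`;
(ii) replacing `(v, x, y)` by `(ξv, ξx, y)` yields the same pair `(X, Y)`;
(iii) if `v ≠ 0`, `v' ≠ 0`, `v'³ = a`, `y'² = x'³ + 1` and
`(v'²x', v'³y') = (v²x, v³y)`, then `v' = ξᵏv`, `x' = ξᵏx`, `y' = y` for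
some `k ∈ {0, 1, 2}`. -/
theorem birational_quotient_to_Sf (ξ a : ℂ) (hξ : IsPrimitiveRoot ξ 3) :
    (∀ v x y : ℂ, v ^ 3 = a → y ^ 2 = x ^ 3 + 1 →
      (v ^ 3 * y) ^ 2 = (v ^ 2 * x) ^ 3 + a ^ 2) ∧
    (∀ v x y : ℂ,
      (ξ * v) ^ 2 * (ξ * x) = v ^ 2 * x ∧ (ξ * v) ^ 3 * y = v ^ 3 * y) ∧
    (∀ v v' x x' y y' : ℂ, v ≠ 0 → v' ≠ 0 → v ^ 3 = a → v' ^ 3 = a →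
      y ^ 2 = x ^ 3 + 1 → y' ^ 2 = x' ^ 3 + 1 →
      v' ^ 2 * x' = v ^ 2 * x → v' ^ 3 * y' = v ^ 3 * y →
      ∃ k : ℕ, k < 3 ∧ v' = ξ ^ k * v ∧ x' = ξ ^ k * x ∧ y' = y) := by
  have hξ3 : ξ ^ 3 = 1 := hξ.pow_eq_one
  refine ⟨fun v x y hv hy => ?_, fun v x y => ⟨?_, ?_⟩, ?_⟩
  · rw [← hv]
    linear_combination v ^ 6 * hy
  · linear_combination v ^ 2 * x * hξ3
  · linear_combination v ^ 3 * y * hξ3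
  · intro v v' x x' y y' hv hv' hva hva' _ _ hX hY
    have hroot : (v' / v) ^ 3 = 1 := by
      rw [div_pow, hva, hva', div_self (hva ▸ pow_ne_zero 3 hv)]
    obtain ⟨k, hk, hkv⟩ := hξ.eq_pow_of_pow_eq_one hroot
    have hv'_eq : v' = ξ ^ k * v := by rw [hkv, div_mul_cancel₀ _ hv]
    have hξk : (ξ ^ k) ^ 3 = 1 := by rw [← pow_mul, mul_comm, pow_mul, hξ3, one_pow]
    refine ⟨k, hk, hv'_eq, ?_, ?_⟩
    · apply mul_left_cancel₀ (pow_ne_zero 2 hv')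
      rw [hX, hv'_eq]
      linear_combination -(v ^ 2 * x) * hξk
    · apply mul_left_cancel₀ (pow_ne_zero 3 hv')
      rw [hY, hva, hva']
end
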